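/- There exist constants C₀, C > 0 independent of ε and N such that, if ε ≤ C₀ N^{−1} and λ = 2ε ln N/√m < 1/4, the consistency error of the scheme at the exact solution satisfies |T(y(x_0),…,y(x_N))_i| ≤ C N^{−2} for all i = N/4, …, N/2, where y is the exact solution of the boundary value problem. -/

import Mathlib

/-- The modified Shishkin (Vulanović) mesh-generating function. -/
noncomputable def shishkinPsi (lam t : ℝ) : ℝ :=
  if t ≤ 1 / 2 then
    (if t ≤ 1 / 4 then 4 * lam * t
     else 32 * (1 - 4 * lam) * (t - 1 / 4) ^ 3 + 4 * lam * t)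
  else
    1 - (if 1 - t ≤ 1 / 4 then 4 * lam * (1 - t)
         else 32 * (1 - 4 * lam) * ((1 - t) - 1 / 4) ^ 3 + 4 * lam * (1 - t))

/-- `A(h) = (cosh(βh) − 1)/sinh(βh)`. -/
noncomputable def Acoef (β h : ℝ) : ℝ := (Real.cosh (β * h) - 1) / Real.sinh (β * h)

/-- `B(h) = (cosh(βh) + 1)/sinh(βh)`. -/
noncomputable def Bcoef (β h : ℝ) : ℝ := (Real.cosh (β * h) + 1) / Real.sinh (β * h)

/-- The `i`-th component of the discrete operator `T` generated by the difference
scheme: `Tu_0 = -u_0`, `Tu_N = -u_N`, and for interior `i`,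
`Tu_i = γ/(A(h_{i-1})+A(h_i)) · [ B(h_{i-1})u_{i-1} − (B(h_{i-1})+B(h_i))u_i + B(h_i)u_{i+1}`
`− (f(x_{i-1},u_{i-1})+f(x_i,u_i))A(h_{i-1})/γ − (f(x_i,u_i)+f(x_{i+1},u_{i+1}))A(h_i)/γ ]`. -/
noncomputable def Tdisc (f : ℝ → ℝ → ℝ) (γ β : ℝ) (x : ℕ → ℝ) (N : ℕ)
    (u : ℕ → ℝ) (i : ℕ) : ℝ :=
  if i = 0 ∨ i = N then -u i
  else
    let h : ℕ → ℝ := fun k => x (k + 1) - x k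
    γ / (Acoef β (h (i - 1)) + Acoef β (h i)) *
      (Bcoef β (h (i - 1)) * u (i - 1) -
        (Bcoef β (h (i - 1)) + Bcoef β (h i)) * u i + Bcoef β (h i) * u (i + 1) -
        (f (x (i - 1)) (u (i - 1)) + f (x i) (u i)) * Acoef β (h (i - 1)) / γ -
        (f (x i) (u i) + f (x (i + 1)) (u (i + 1))) * Acoef β (h i) / γ)

theorem abs_sub_le_of_abs_deriv_le {D D1 U U1 : ℝ → ℝ} {a b : ℝ} (hab : a ≤ b)
    (hD : ContinuousOn D (Set.Icc a b)) (hU : ContinuousOn U (Set.Icc a b))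
    (hD1 : ∀ x ∈ Set.Ioo a b, HasDerivAt D (D1 x) x)
    (hU1 : ∀ x ∈ Set.Ioo a b, HasDerivAt U (U1 x) x)
    (h : ∀ x ∈ Set.Ioo a b, |D1 x| ≤ U1 x) : |D b - D a| ≤ U b - U a := by
  have h1 : MonotoneOn (U - D) (Set.Icc a b) := by
    refine monotoneOn_of_hasDerivWithinAt_nonneg (f' := U1 - D1) (convex_Icc a b) (hU.sub hD)
      ?_ ?_ <;> rw [interior_Icc] <;> intro x hx
    · exact ((hU1 x hx).sub (hD1 x hx)).hasDerivWithinAt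
    · have := (abs_le.1 (h x hx)).2
      simpa using this
  have h2 : MonotoneOn (U + D) (Set.Icc a b) := by
    refine monotoneOn_of_hasDerivWithinAt_nonneg (f' := U1 + D1) (convex_Icc a b) (hU.add hD)
      ?_ ?_ <;> rw [interior_Icc] <;> intro x hx
    · exact ((hU1 x hx).add (hD1 x hx)).hasDerivWithinAt
    · have := (abs_le.1 (h x hx)).1
      simp only [Pi.add_apply]
      linarith
  have h1 := h1 (Set.left_mem_Icc.2 hab) (Set.right_mem_Icc.2 hab) hab
  have h2 := h2 (Set.left_mem_Icc.2 hab) (Set.right_mem_Icc.2 hab) hab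
  simp only [Pi.add_apply, Pi.sub_apply] at h1 h2
  rw [abs_le]
  constructor <;> linarith

/-- Error of the exact two-point relation for `v'' = β² v` on `[a, a + h]`. -/
theorem abs_two_point_right {v v1 v2 : ℝ → ℝ} {a h β K : ℝ} (hβ : 0 < β) (hh : 0 ≤ h)
    (hv : ContinuousOn v (Set.Icc a (a + h))) (hv1 : ContinuousOn v1 (Set.Icc a (a + h)))
    (hd : ∀ x ∈ Set.Ioo a (a + h), HasDerivAt v (v1 x) x)
    (hd1 : ∀ x ∈ Set.Ioo a (a + h), HasDerivAt v1 (v2 x) x)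
    (hK : ∀ x ∈ Set.Ioo a (a + h), |v2 x - β ^ 2 * v x| ≤ β ^ 2 * K) :
    |β * (v (a + h) - Real.cosh (β * h) * v a) - Real.sinh (β * h) * v1 a| ≤
      β * K * (Real.cosh (β * h) - 1) := by
  have harg : ∀ x, HasDerivAt (fun x : ℝ => β * (a + h - x)) (-β) x := fun x => by
    simpa using ((hasDerivAt_id x).const_sub (a + h)).const_mul β
  have key := abs_sub_le_of_abs_deriv_le (a := a) (b := a + h)
    (D := fun x => Real.sinh (β * (a + h - x)) * v1 x + β * (Real.cosh (β * (a + h - x)) * v x))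
    (D1 := fun x => Real.sinh (β * (a + h - x)) * (v2 x - β ^ 2 * v x))
    (U := fun x => -(β * K) * Real.cosh (β * (a + h - x)))
    (U1 := fun x => Real.sinh (β * (a + h - x)) * (β ^ 2 * K)) (by linarith)
    (by fun_prop) (by fun_prop) (fun x hx => by
      convert! ((harg x).sinh.mul (hd1 x hx)).add (((harg x).cosh.mul (hd x hx)).const_mul β) using 1
      ring) (fun x hx => by
      convert! (harg x).cosh.const_mul (-(β * K)) using 1
      ring) (fun x hx => by
      have : 0 ≤ Real.sinh (β * (a + h - x)) :=
        Real.sinh_nonneg_iff.2 (mul_nonneg hβ.le (by linarith [hx.2]))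
      rw [abs_mul, abs_of_nonneg this]
      exact mul_le_mul_of_nonneg_left (hK x hx) this)
  simp only [sub_self, mul_zero, Real.sinh_zero, Real.cosh_zero, zero_mul, add_sub_cancel_left]
    at key
  convert key using 1
  · congr 1
    ring
  · ring

theorem abs_two_point_left {v v1 v2 : ℝ → ℝ} {a h β K : ℝ} (hβ : 0 < β) (hh : 0 ≤ h)
    (hv : ContinuousOn v (Set.Icc (a - h) a)) (hv1 : ContinuousOn v1 (Set.Icc (a - h) a))
    (hd : ∀ x ∈ Set.Ioo (a - h) a, HasDerivAt v (v1 x) x)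
    (hd1 : ∀ x ∈ Set.Ioo (a - h) a, HasDerivAt v1 (v2 x) x)
    (hK : ∀ x ∈ Set.Ioo (a - h) a, |v2 x - β ^ 2 * v x| ≤ β ^ 2 * K) :
    |β * (v (a - h) - Real.cosh (β * h) * v a) + Real.sinh (β * h) * v1 a| ≤
      β * K * (Real.cosh (β * h) - 1) := by
  have harg : ∀ x, HasDerivAt (fun x : ℝ => 2 * a - x) (-1) x := fun x => by
    simpa using (hasDerivAt_id x).const_sub (2 * a)
  have hmaps : Set.MapsTo (fun x : ℝ => 2 * a - x) (Set.Icc a (a + h)) (Set.Icc (a - h) a) :=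
    fun x hx => ⟨by linarith [hx.2], by linarith [hx.1]⟩
  have hmem : ∀ x ∈ Set.Ioo a (a + h), 2 * a - x ∈ Set.Ioo (a - h) a :=
    fun x hx => ⟨by linarith [hx.2], by linarith [hx.1]⟩
  have key := abs_two_point_right (a := a) (v := fun x => v (2 * a - x))
    (v1 := fun x => -v1 (2 * a - x)) (v2 := fun x => v2 (2 * a - x)) hβ hh
    (hv.comp (by fun_prop) hmaps) (hv1.comp (by fun_prop) hmaps).neg
    (fun x hx => by
      convert! (hd _ (hmem x hx)).comp x (harg x) using 1
      ring) (fun x hx => by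
      convert! ((hd1 _ (hmem x hx)).comp x (harg x)).neg using 1
      ring) (fun x hx => hK _ (hmem x hx))
  have e1 : 2 * a - (a + h) = a - h := by ring
  have e2 : 2 * a - a = a := by ring
  simp only [e1, e2] at key
  convert key using 2
  ring

theorem cosh_sub_one_div_sinh_le {a b : ℝ} (ha : 0 < a) (hab : a ≤ b) :
    (Real.cosh a - 1) / Real.sinh a ≤ (Real.cosh b - 1) / Real.sinh b := by
  have hsa : 0 < Real.sinh a := Real.sinh_pos_iff.2 ha
  have hsb : 0 < Real.sinh b := Real.sinh_pos_iff.2 (ha.trans_le hab)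
  rw [div_le_div_iff₀ hsa hsb]
  have h1 := Real.sinh_sub b a
  have h2 := Real.sinh_add (b - a) a
  rw [sub_add_cancel] at h2
  have h3 : 0 ≤ Real.sinh (b - a) := Real.sinh_nonneg_iff.2 (by linarith)
  have h4 := Real.one_le_cosh a
  have h5 := Real.one_le_cosh (b - a)
  nlinarith [mul_nonneg h3 (sub_nonneg.2 h4), mul_nonneg hsa.le (sub_nonneg.2 h5)]

theorem two_mul_sinh_le {θ : ℝ} (hθ : 0 ≤ θ) :
    2 * Real.sinh θ ≤ θ * (Real.cosh θ + 1) := by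
  have d : ∀ x, HasDerivAt (fun x => x * (Real.cosh x + 1) - 2 * Real.sinh x)
      (x * Real.sinh x - (Real.cosh x - 1)) x := fun x => by
    convert! ((hasDerivAt_id x).mul ((Real.hasDerivAt_cosh x).add_const 1)).sub
      ((Real.hasDerivAt_sinh x).const_mul 2) using 1
    simp
    ring
  have d2 : ∀ x, HasDerivAt (fun x => x * Real.sinh x - (Real.cosh x - 1))
      (x * Real.cosh x) x := fun x => by
    convert! ((hasDerivAt_id x).mul (Real.hasDerivAt_sinh x)).sub
      ((Real.hasDerivAt_cosh x).sub_const 1) using 1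
    simp
  have m2 : MonotoneOn (fun x => x * Real.sinh x - (Real.cosh x - 1)) (Set.Ici 0) := by
    refine monotoneOn_of_hasDerivWithinAt_nonneg (convex_Ici 0) (by fun_prop)
      (fun x hx => (d2 x).hasDerivWithinAt) (fun x hx => ?_)
    rw [interior_Ici] at hx
    exact mul_nonneg (le_of_lt hx) (Real.cosh_pos x).le
  have m1 : MonotoneOn (fun x => x * (Real.cosh x + 1) - 2 * Real.sinh x) (Set.Ici 0) := by
    refine monotoneOn_of_hasDerivWithinAt_nonneg (convex_Ici 0) (by fun_prop)
      (fun x hx => (d x).hasDerivWithinAt) (fun x hx => ?_)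
    rw [interior_Ici] at hx
    have := m2 (Set.self_mem_Ici) (Set.mem_Ici.2 (le_of_lt hx)) (le_of_lt hx)
    simpa using this
  have := m1 (Set.self_mem_Ici) (Set.mem_Ici.2 hθ) hθ
  simp only [Real.sinh_zero, zero_mul, mul_zero, sub_zero] at this
  linarith

theorem abs_mul_coth_sub_le {a b : ℝ} (ha : 0 < a) (hab : a ≤ b) :
    |b * ((Real.cosh b + 1) / Real.sinh b) - a * ((Real.cosh a + 1) / Real.sinh a)| ≤
      (b - a) * ((Real.cosh b - 1) / Real.sinh b) := by
  have hs : ∀ x ∈ Set.Icc a b, Real.sinh x ≠ 0 := fun x hx =>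
    (Real.sinh_pos_iff.2 (ha.trans_le hx.1)).ne'
  have key := abs_sub_le_of_abs_deriv_le hab
    (D := fun x => x * ((Real.cosh x + 1) / Real.sinh x))
    (D1 := fun x => (Real.cosh x + 1) * (Real.sinh x - x) / Real.sinh x ^ 2)
    (U := fun x => x * ((Real.cosh b - 1) / Real.sinh b))
    (U1 := fun _ => (Real.cosh b - 1) / Real.sinh b)
    (continuousOn_id.mul ((by fun_prop : ContinuousOn (fun x => Real.cosh x + 1) _).div
      (by fun_prop) hs)) (by fun_prop)
    (fun x hx => by
      have hx0 := hs x (Set.Ioo_subset_Icc_self hx)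
      convert! (hasDerivAt_id x).mul (((Real.hasDerivAt_cosh x).add_const 1).div
        (Real.hasDerivAt_sinh x) hx0) using 1
      have := Real.cosh_sq x
      simp only [id, Pi.div_apply]
      field_simp
      linear_combination x * this)
    (fun x hx => by simpa using (hasDerivAt_id x).mul_const ((Real.cosh b - 1) / Real.sinh b))
    (fun x hx => by
      have hx0 : 0 < x := ha.trans hx.1
      have hsx : 0 < Real.sinh x := Real.sinh_pos_iff.2 hx0
      have h1 : x ≤ Real.sinh x := Real.self_le_sinh_iff.2 hx0.le
      have h2 := Real.cosh_pos x
      refine le_trans ?_ (cosh_sub_one_div_sinh_le hx0 hx.2.le)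
      rw [abs_of_nonneg (div_nonneg (mul_nonneg (by linarith) (by linarith)) (by positivity)),
        div_le_div_iff₀ (by positivity) hsx]
      nlinarith [two_mul_sinh_le hx0.le, mul_pos hsx hsx])
  rw [sub_mul]
  exact key

theorem nonpos_of_isLocalMax {z z1 : ℝ → ℝ} {z2 x : ℝ}
    (hz : ∀ᶠ t in nhds x, HasDerivAt z (z1 t) t) (hz1 : HasDerivAt z1 z2 x)
    (hmax : IsLocalMax z x) : z2 ≤ 0 := by
  by_contra! hpos
  have he : deriv z =ᶠ[nhds x] z1 := hz.mono fun t ht => ht.deriv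
  have hmin : IsLocalMin z x := isLocalMin_of_deriv_deriv_pos
    (by rw [he.deriv_eq, hz1.deriv]; exact hpos) hmax.deriv_eq_zero hz.self_of_nhds.continuousAt
  have hconst : z =ᶠ[nhds x] fun _ => z x := by
    filter_upwards [hmax, hmin] with t h1 h2 using le_antisymm h1 h2
  have h0 : z1 =ᶠ[nhds x] fun _ => 0 := by
    filter_upwards [he, hconst.deriv] with t h1 h2
    rw [← h1, h2, deriv_const]
  have := hz1.deriv
  rw [h0.deriv_eq, deriv_const] at this
  linarith

/-- One-sided comparison of a solution with a reduced solution that is only touched from above by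
parabolas. -/
theorem sub_le_layer_barrier {y y1 y2 g c : ℝ → ℝ} {ε m R M : ℝ} (hε : 0 < ε) (hm : 0 < m)
    (hR : 0 ≤ R) (hM : 0 ≤ M)
    (hy : ContinuousOn y (Set.Icc 0 1)) (hg : ContinuousOn g (Set.Icc 0 1))
    (hd : ∀ x ∈ Set.Ioo (0 : ℝ) 1, HasDerivAt y (y1 x) x)
    (hd1 : ∀ x ∈ Set.Ioo (0 : ℝ) 1, HasDerivAt y1 (y2 x) x)
    (hgc : ∀ x ∈ Set.Icc (0 : ℝ) 1, ∀ t ∈ Set.Icc (0 : ℝ) 1,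
      g t ≤ g x + c x * (t - x) + M * (t - x) ^ 2)
    (hlow : ∀ x ∈ Set.Ioo (0 : ℝ) 1, 0 < y x - g x → m * (y x - g x) ≤ ε ^ 2 * y2 x)
    (h0 : y 0 - g 0 ≤ R) (h1 : y 1 - g 1 ≤ R) :
    ∀ x ∈ Set.Icc (0 : ℝ) 1, y x - g x ≤
      R * (Real.exp (-(Real.sqrt m / ε) * x) + Real.exp (-(Real.sqrt m / ε) * (1 - x))) +
        2 * M / m * ε ^ 2 := by
  set s := Real.sqrt m / ε with hs
  have hs2 : ε ^ 2 * s ^ 2 = m := by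
    rw [hs, div_pow, Real.sq_sqrt hm.le]
    field_simp
  set φ : ℝ → ℝ := fun x => R * (Real.exp (-s * x) + Real.exp (-s * (1 - x))) + 2 * M / m * ε ^ 2
    with hφ
  set φ1 : ℝ → ℝ := fun x => R * (-s * Real.exp (-s * x) + s * Real.exp (-s * (1 - x))) with hφ1
  set φ2 : ℝ → ℝ := fun x => R * s ^ 2 * (Real.exp (-s * x) + Real.exp (-s * (1 - x))) with hφ2
  have dl : ∀ x, HasDerivAt (fun x => Real.exp (-s * x)) (-s * Real.exp (-s * x)) x := fun x => by
    convert! ((hasDerivAt_id x).const_mul (-s)).exp using 1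
    simp
    ring
  have dr : ∀ x, HasDerivAt (fun x => Real.exp (-s * (1 - x))) (s * Real.exp (-s * (1 - x))) x :=
    fun x => by
      convert! (((hasDerivAt_id x).const_sub 1).const_mul (-s)).exp using 1
      simp
      ring
  have dφ : ∀ x, HasDerivAt φ (φ1 x) x := fun x =>
    (((dl x).add (dr x)).const_mul R).add_const _
  have dφ1 : ∀ x, HasDerivAt φ1 (φ2 x) x := fun x => by
    convert! (((dl x).const_mul (-s)).add ((dr x).const_mul s)).const_mul R using 1
    simp only [hφ2]
    ring
  have hφpos : ∀ x, 0 ≤ φ x := fun x => by positivity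
  have hφ0 : R ≤ φ 0 := by
    have : 0 ≤ R * Real.exp (-s * (1 - 0)) + 2 * M / m * ε ^ 2 := by positivity
    simp only [hφ, mul_zero, Real.exp_zero]
    linarith
  have hφe : R ≤ φ 1 := by
    have : 0 ≤ R * Real.exp (-s * 1) + 2 * M / m * ε ^ 2 := by positivity
    simp only [hφ, sub_self, mul_zero, Real.exp_zero]
    linarith
  have hcont : ContinuousOn (fun x => y x - g x - φ x) (Set.Icc 0 1) :=
    (hy.sub hg).sub (fun x _ => (dφ x).continuousAt.continuousWithinAt)
  obtain ⟨x, hx, hmax⟩ := isCompact_Icc.exists_isMaxOn ⟨0, by simp⟩ hcont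
  intro t ht
  have htx : y t - g t - φ t ≤ y x - g x - φ x := hmax ht
  suffices y x - g x - φ x ≤ 0 by linarith
  by_contra! hpos
  have hxo : x ∈ Set.Ioo (0 : ℝ) 1 := by
    refine ⟨lt_of_le_of_ne hx.1 ?_, lt_of_le_of_ne hx.2 ?_⟩
    · rintro rfl
      linarith
    · rintro rfl
      linarith
  have hnhds : Set.Ioo (0 : ℝ) 1 ∈ nhds x := isOpen_Ioo.mem_nhds hxo
  have d1 : ∀ t, HasDerivAt (fun t => c x * (t - x) + M * (t - x) ^ 2)
      (c x + 2 * M * (t - x)) t := fun t => by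
    convert! (((hasDerivAt_id t).sub_const x).const_mul (c x)).add
      ((((hasDerivAt_id t).sub_const x).pow 2).const_mul M) using 1
    simp
    ring
  have d2 : HasDerivAt (fun t => c x + 2 * M * (t - x)) (2 * M) x := by
    simpa using (((hasDerivAt_id x).sub_const x).const_mul (2 * M)).const_add (c x)
  have key := nonpos_of_isLocalMax (x := x)
    (z := fun t => y t - (c x * (t - x) + M * (t - x) ^ 2) - φ t)
    (z1 := fun t => y1 t - (c x + 2 * M * (t - x)) - φ1 t)
    (z2 := y2 x - 2 * M - φ2 x)
    (by filter_upwards [hnhds] with t ht using ((hd t ht).sub (d1 t)).sub (dφ t))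
    (((hd1 x hxo).sub d2).sub (dφ1 x))
    (by
      filter_upwards [hnhds] with t ht
      have h2 : y t - g t - φ t ≤ y x - g x - φ x := hmax (Set.Ioo_subset_Icc_self ht)
      have h3 := hgc x hx t (Set.Ioo_subset_Icc_self ht)
      simp only [sub_self]
      linarith)
  have h5 := hlow x hxo (by linarith [hφpos x])
  have h6 : ε ^ 2 * (y2 x - 2 * M - φ2 x) ≤ 0 := mul_nonpos_of_nonneg_of_nonpos (by positivity) key
  have h7 : m * φ x = ε ^ 2 * φ2 x + 2 * M * ε ^ 2 := by
    simp only [hφ, hφ2]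
    field_simp
    linear_combination (-(R * (Real.exp (-(s * x)) + Real.exp (-(s * (1 - x)))))) * hs2
  nlinarith

theorem exists_taylor_bound {f : ℝ → ℝ → ℝ}
    (hf : ContDiffOn ℝ 2 (Function.uncurry f) (Set.Icc 0 1 ×ˢ Set.univ)) (R : ℝ) :
    ∃ (p q : ℝ → ℝ → ℝ) (P : ℝ), 0 ≤ P ∧
      (∀ a ∈ Set.Icc (0 : ℝ) 1, ∀ u, HasDerivAt (f a) (q a u) u) ∧
      ∀ a ∈ Set.Icc (0 : ℝ) 1, ∀ u ∈ Set.Icc (-R) R, |p a u| ≤ P ∧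
        ∀ b ∈ Set.Icc (0 : ℝ) 1, ∀ w ∈ Set.Icc (-R) R,
          |f b w - f a u| ≤ P * max |b - a| |w - u| ∧
          |f b w - f a u - (p a u * (b - a) + q a u * (w - u))| ≤
            P * (max |b - a| |w - u|) ^ 2 := by
  set S : Set (ℝ × ℝ) := Set.Icc 0 1 ×ˢ Set.univ with hS
  set F := Function.uncurry f with hF
  have huS : UniqueDiffOn ℝ S := (uniqueDiffOn_Icc one_pos).prod uniqueDiffOn_univ
  have hF1 : ContDiffOn ℝ 1 (fderivWithin ℝ F S) S := hf.fderivWithin huS (by norm_num)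
  set K : Set (ℝ × ℝ) := Set.Icc 0 1 ×ˢ Set.Icc (-R) R with hK
  have hKS : K ⊆ S := Set.prod_mono subset_rfl (Set.subset_univ _)
  have hKc : IsCompact K := isCompact_Icc.prod isCompact_Icc
  have hKconv : Convex ℝ K := (convex_Icc 0 1).prod (convex_Icc _ _)
  have hdF : ∀ z ∈ S, HasFDerivWithinAt F (fderivWithin ℝ F S z) S z := fun z hz =>
    (hf.differentiableOn (by norm_num) z hz).hasFDerivWithinAt
  have hdF1 : ∀ z ∈ S, HasFDerivWithinAt (fderivWithin ℝ F S)
      (fderivWithin ℝ (fderivWithin ℝ F S) S z) S z := fun z hz =>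
    (hF1.differentiableOn (by norm_num) z hz).hasFDerivWithinAt
  obtain ⟨P1, hP1⟩ := hKc.exists_bound_of_continuousOn (hF1.continuousOn.mono hKS)
  obtain ⟨P2, hP2⟩ := hKc.exists_bound_of_continuousOn
    ((hF1.continuousOn_fderivWithin huS (by norm_num)).mono hKS)
  refine ⟨fun a u => fderivWithin ℝ F S (a, u) (1, 0), fun a u => fderivWithin ℝ F S (a, u) (0, 1),
    max 0 (max P1 P2), le_max_left _ _, ?_, ?_⟩
  · intro a ha u
    have h1 : HasDerivAt (fun t : ℝ => (a, t)) ((0 : ℝ), (1 : ℝ)) u :=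
      (hasDerivAt_const u a).prodMk (hasDerivAt_id u)
    have h2 := (hdF (a, u) ⟨ha, trivial⟩).comp_hasDerivWithinAt (s := Set.univ) u
      h1.hasDerivWithinAt (fun t _ => ⟨ha, trivial⟩)
    rw [hasDerivWithinAt_univ] at h2
    exact h2
  · intro a ha u hu
    have hau : (a, u) ∈ K := ⟨ha, hu⟩
    have hP1' : P1 ≤ max 0 (max P1 P2) := (le_max_left _ _).trans (le_max_right _ _)
    have hP2' : P2 ≤ max 0 (max P1 P2) := (le_max_right _ _).trans (le_max_right _ _)
    have hP2n : 0 ≤ P2 := (norm_nonneg _).trans (hP2 _ hau)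
    refine ⟨?_, ?_⟩
    · have h := (fderivWithin ℝ F S (a, u)).le_of_opNorm_le (hP1 _ hau) (1, 0)
      have hn : ‖((1 : ℝ), (0 : ℝ))‖ = 1 := by simp [Prod.norm_def]
      rw [hn, mul_one] at h
      exact h.trans hP1'
    · intro b hb w hw
      have hbw : (b, w) ∈ K := ⟨hb, hw⟩
      have hn : ‖((b, w) : ℝ × ℝ) - (a, u)‖ = max |b - a| |w - u| := by
        simp [Prod.norm_def]
      have hmax : 0 ≤ max |b - a| |w - u| := (abs_nonneg _).trans (le_max_left _ _)
      refine ⟨?_, ?_⟩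
      · have h := hKconv.norm_image_sub_le_of_norm_hasFDerivWithin_le
          (fun z hz => (hdF z (hKS hz)).mono hKS) hP1 hau hbw
        rw [hn] at h
        exact h.trans (mul_le_mul_of_nonneg_right hP1' hmax)
      · have hseg : segment ℝ ((a, u) : ℝ × ℝ) (b, w) ⊆ K := hKconv.segment_subset hau hbw
        have h := (convex_segment (𝕜 := ℝ) ((a, u) : ℝ × ℝ) (b, w)).norm_image_sub_le_of_norm_hasFDerivWithin_le'
          (f := F) (f' := fderivWithin ℝ F S) (φ := fderivWithin ℝ F S (a, u))
          (C := P2 * max |b - a| |w - u|)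
          (fun z hz => (hdF z (hKS (hseg hz))).mono (hseg.trans hKS))
          (fun z hz => by
            have h := hKconv.norm_image_sub_le_of_norm_hasFDerivWithin_le
              (fun z hz => (hdF1 z (hKS hz)).mono hKS) hP2 hau (hseg hz)
            refine h.trans (mul_le_mul_of_nonneg_left ?_ hP2n)
            rw [← hn]
            have := norm_sub_le_of_mem_segment hz
            simpa using this)
          (left_mem_segment ℝ _ _) (right_mem_segment ℝ _ _)
        rw [hn] at h
        have hlin : fderivWithin ℝ F S (a, u) ((b, w) - (a, u)) =
            fderivWithin ℝ F S (a, u) (1, 0) * (b - a) +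
              fderivWithin ℝ F S (a, u) (0, 1) * (w - u) := by
          have : ((b, w) : ℝ × ℝ) - (a, u) = (b - a) • (1, 0) + (w - u) • (0, 1) := by
            ext <;> simp
          rw [this, map_add, map_smul, map_smul, smul_eq_mul, smul_eq_mul]
          ring
        rw [hlin] at h
        refine h.trans ?_
        nlinarith [mul_le_mul_of_nonneg_right hP2' (sq_nonneg (max |b - a| |w - u|))]

theorem slope_bounds {φ q : ℝ → ℝ} {m γ : ℝ} (hd : ∀ u, HasDerivAt φ (q u) u)
    (hm : ∀ u, m ≤ q u) (hγ : ∀ u, q u ≤ γ) {u w : ℝ} (huw : u ≤ w) :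
    m * (w - u) ≤ φ w - φ u ∧ φ w - φ u ≤ γ * (w - u) :=
  ⟨mul_sub_le_image_sub_of_le_deriv (fun x => (hd x).differentiableAt)
      (fun x => by rw [(hd x).deriv]; exact hm x) huw,
    image_sub_le_mul_sub_of_deriv_le (fun x => (hd x).differentiableAt)
      (fun x => by rw [(hd x).deriv]; exact hγ x) huw⟩

/-- The reduced equation `f(x, g) = 0` has a bounded solution with uniform second order
expansions. -/
theorem exists_reduced_solution {f : ℝ → ℝ → ℝ} {m γ : ℝ} (hm : 0 < m)
    (hf : ContDiffOn ℝ 2 (Function.uncurry f) (Set.Icc 0 1 ×ˢ Set.univ))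
    (hfy : ∀ a ∈ Set.Icc (0 : ℝ) 1, ∀ u : ℝ, m ≤ deriv (f a) u)
    (hγ : ∀ a ∈ Set.Icc (0 : ℝ) 1, ∀ u : ℝ, deriv (f a) u ≤ γ) :
    (∀ a ∈ Set.Icc (0 : ℝ) 1, ∀ u w, u ≤ w →
      m * (w - u) ≤ f a w - f a u ∧ f a w - f a u ≤ γ * (w - u)) ∧
    ∃ (g c : ℝ → ℝ) (R L M : ℝ), 0 ≤ R ∧ 0 ≤ L ∧ 0 ≤ M ∧ ContinuousOn g (Set.Icc 0 1) ∧
      ∀ a ∈ Set.Icc (0 : ℝ) 1, f a (g a) = 0 ∧ |g a| ≤ R ∧ |c a| ≤ L ∧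
        ∀ b ∈ Set.Icc (0 : ℝ) 1, |g b - g a - c a * (b - a)| ≤ M * (b - a) ^ 2 := by
  have hslope : ∀ a ∈ Set.Icc (0 : ℝ) 1, ∀ u w, u ≤ w →
      m * (w - u) ≤ f a w - f a u ∧ f a w - f a u ≤ γ * (w - u) := by
    obtain ⟨p, q, P, hP, hq, -⟩ := exists_taylor_bound hf 0
    intro a ha u w huw
    exact slope_bounds (hq a ha) (fun u => by rw [← (hq a ha u).deriv]; exact hfy a ha u)
      (fun u => by rw [← (hq a ha u).deriv]; exact hγ a ha u) huw
  refine ⟨hslope, ?_⟩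
  have hf0 : ContinuousOn (fun a => f a 0) (Set.Icc 0 1) :=
    hf.continuousOn.comp (f := fun a : ℝ => (a, (0 : ℝ))) (by fun_prop) (fun a ha => ⟨ha, trivial⟩)
  obtain ⟨R0, hR0⟩ := isCompact_Icc.exists_bound_of_continuousOn hf0
  have hR0n : 0 ≤ R0 := (norm_nonneg _).trans (hR0 0 (by simp))
  set R := R0 / m with hR
  have hRn : 0 ≤ R := by positivity
  have hmR : m * R = R0 := by rw [hR]; field_simp
  obtain ⟨p, q, P, hP, hq, hT⟩ := exists_taylor_bound hf R
  have hex : ∀ a ∈ Set.Icc (0 : ℝ) 1, ∃ u ∈ Set.Icc (-R) R, f a u = 0 := by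
    intro a ha
    have h0 := abs_le.1 (hR0 a ha)
    have hc : ContinuousOn (f a) (Set.Icc (-R) R) := fun u _ =>
      (hq a ha u).continuousAt.continuousWithinAt
    have h1 := (hslope a ha (-R) 0 (by linarith)).1
    have h2 := (hslope a ha 0 R hRn).1
    exact intermediate_value_Icc (by linarith) hc ⟨by linarith, by linarith⟩
  choose! g hg hfg using hex
  have hqm : ∀ a ∈ Set.Icc (0 : ℝ) 1, ∀ u, m ≤ q a u := fun a ha u => by
    rw [← (hq a ha u).deriv]; exact hfy a ha u
  have habs : ∀ a ∈ Set.Icc (0 : ℝ) 1, ∀ u w, m * |w - u| ≤ |f a w - f a u| := by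
    intro a ha u w
    rcases le_total u w with h | h
    · rw [abs_of_nonneg (sub_nonneg.2 h)]
      exact (hslope a ha u w h).1.trans (le_abs_self _)
    · rw [abs_sub_comm w u, abs_sub_comm (f a w), abs_of_nonneg (sub_nonneg.2 h)]
      exact (hslope a ha w u h).1.trans (le_abs_self _)
  have hlip : ∀ a ∈ Set.Icc (0 : ℝ) 1, ∀ b ∈ Set.Icc (0 : ℝ) 1,
      |g b - g a| ≤ P / m * |b - a| := by
    intro a ha b hb
    have h1 := habs b hb (g a) (g b)
    have h2 := ((hT a ha (g a) (hg a ha)).2 b hb (g a) (hg a ha)).1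
    rw [hfg a ha] at h2
    rw [hfg b hb, zero_sub, abs_neg] at h1
    rw [sub_self, abs_zero, max_eq_left (abs_nonneg _), sub_zero] at h2
    rw [div_mul_eq_mul_div, le_div_iff₀ hm]
    linarith
  refine ⟨g, fun a => -p a (g a) / q a (g a), R, P / m, P * (1 + P / m) ^ 2 / m, hRn,
    by positivity, by positivity, ?_, ?_⟩
  · have : LipschitzOnWith (Real.toNNReal (P / m)) g (Set.Icc 0 1) :=
      LipschitzOnWith.of_dist_le_mul fun a ha b hb => by
        rw [Real.coe_toNNReal _ (by positivity), Real.dist_eq, Real.dist_eq]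
        exact hlip b hb a ha
    exact this.continuousOn
  · intro a ha
    have hqa := hqm a ha (g a)
    have hqpos : 0 < q a (g a) := hm.trans_le hqa
    obtain ⟨hp, hTa⟩ := hT a ha (g a) (hg a ha)
    refine ⟨hfg a ha, abs_le.2 (hg a ha), ?_, ?_⟩
    · rw [abs_div, abs_neg, abs_of_pos hqpos]
      exact div_le_div₀ hP hp hm hqa
    · intro b hb
      have h := (hTa b hb (g b) (hg b hb)).2
      rw [hfg a ha, hfg b hb] at h
      have hle : max |b - a| |g b - g a| ≤ (1 + P / m) * |b - a| := by
        have : 0 ≤ P / m * |b - a| := by positivity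
        refine max_le (by linarith) ?_
        linarith [hlip a ha b hb, abs_nonneg (b - a)]
      have h2 : (max |b - a| |g b - g a|) ^ 2 ≤ (1 + P / m) ^ 2 * (b - a) ^ 2 := by
        calc _ ≤ ((1 + P / m) * |b - a|) ^ 2 :=
              pow_le_pow_left₀ ((abs_nonneg _).trans (le_max_left _ _)) hle 2
          _ = _ := by rw [mul_pow, sq_abs]
      have e : g b - g a - -p a (g a) / q a (g a) * (b - a) =
          -(0 - 0 - (p a (g a) * (b - a) + q a (g a) * (g b - g a))) / q a (g a) := by
        field_simp
        ring
      rw [e, abs_div, abs_neg, abs_of_pos hqpos]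
      calc _ ≤ P * (max |b - a| |g b - g a|) ^ 2 / m :=
            div_le_div₀ (by positivity) h hm hqa
        _ ≤ P * ((1 + P / m) ^ 2 * (b - a) ^ 2) / m := by gcongr
        _ = _ := by ring

theorem shishkinPsi_of_mem {lam t : ℝ} (h1 : 1 / 4 ≤ t) (h2 : t ≤ 1 / 2) :
    shishkinPsi lam t = 32 * (1 - 4 * lam) * (t - 1 / 4) ^ 3 + 4 * lam * t := by
  rw [shishkinPsi, if_pos h2]
  split_ifs with h
  · rw [le_antisymm h h1]
    ring
  · rfl

theorem shishkinPsi_of_le {lam t : ℝ} (h : t ≤ 1 / 4) : shishkinPsi lam t = 4 * lam * t := by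
  rw [shishkinPsi, if_pos (by linarith), if_pos h]

theorem shishkinPsi_one_sub {lam t : ℝ} (ht : t < 1 / 2) :
    shishkinPsi lam (1 - t) = 1 - shishkinPsi lam t := by
  rw [shishkinPsi, shishkinPsi, if_neg (by linarith), if_pos ht.le, sub_sub_cancel]

theorem shishkinPsi_neighbours {lam t d : ℝ} (hl0 : 0 < lam) (hl : lam < 1 / 4) (hd : 0 < d)
    (hd4 : d ≤ 1 / 4)
    (ht : t = 1 / 4 ∨ (1 / 4 + d ≤ t ∧ t + d ≤ 1 / 2) ∨ t = 1 / 2) :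
    let ψ := shishkinPsi lam
    ψ (t - d) < ψ t ∧ ψ t - ψ (t - d) ≤ ψ (t + d) - ψ t ∧ ψ (t + d) - ψ t ≤ 15 * d ∧
      (ψ (t + d) - ψ t) - (ψ t - ψ (t - d)) ≤ 48 * d ^ 2 ∧
      lam * (1 - 4 * d) ≤ ψ (t - d) ∧ ψ (t + d) ≤ 1 - lam * (1 - 4 * d) := by
  intro ψ
  set q := 1 - 4 * lam with hq
  have hq0 : 0 < q := by rw [hq]; linarith
  have hld : 0 < lam * d := by positivity
  have hd3 : d ^ 3 ≤ d ^ 2 / 4 := by nlinarith [sq_nonneg d]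
  have hd2 : d ^ 2 ≤ d / 4 := by nlinarith
  have hq3 : q * d ^ 3 ≤ d ^ 3 := by nlinarith [pow_pos hd 3]
  have hld4 : lam * d ≤ d / 4 := by nlinarith
  have hqd3 : 0 < q * d ^ 3 := by positivity
  rcases ht with rfl | ⟨h1, h2⟩ | rfl
  · have e1 : ψ (1 / 4 - d) = 4 * lam * (1 / 4 - d) := shishkinPsi_of_le (by linarith)
    have e2 : ψ (1 / 4) = 4 * lam * (1 / 4) := shishkinPsi_of_le le_rfl
    have e3 : ψ (1 / 4 + d) = 32 * q * (1 / 4 + d - 1 / 4) ^ 3 + 4 * lam * (1 / 4 + d) :=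
      shishkinPsi_of_mem (by linarith) (by linarith)
    rw [e1, e2, e3]
    refine ⟨?_, ?_, ?_, ?_, ?_, ?_⟩ <;> linarith
  · obtain ⟨s, rfl⟩ : ∃ s, t = s + 1 / 4 := ⟨t - 1 / 4, by ring⟩
    have e1 : ψ (s + 1 / 4 - d) = 32 * q * (s + 1 / 4 - d - 1 / 4) ^ 3 + 4 * lam * (s + 1 / 4 - d) :=
      shishkinPsi_of_mem (by linarith) (by linarith)
    have e2 : ψ (s + 1 / 4) = 32 * q * (s + 1 / 4 - 1 / 4) ^ 3 + 4 * lam * (s + 1 / 4) :=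
      shishkinPsi_of_mem (by linarith) (by linarith)
    have e3 : ψ (s + 1 / 4 + d) = 32 * q * (s + 1 / 4 + d - 1 / 4) ^ 3 + 4 * lam * (s + 1 / 4 + d) :=
      shishkinPsi_of_mem (by linarith) (by linarith)
    have hsd : d ≤ s := by linarith
    have hs4 : s + d ≤ 1 / 4 := by linarith
    have hqu : ∀ z, 0 ≤ z → q * z ≤ z := fun z hz => by nlinarith
    have hc0 : 0 ≤ q * (s - d) ^ 3 := mul_nonneg hq0.le (pow_nonneg (by linarith) 3)
    have hc1 : q * (s - d) ^ 3 ≤ q * s ^ 3 :=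
      mul_le_mul_of_nonneg_left (pow_le_pow_left₀ (by linarith) (by linarith) 3) hq0.le
    have hc3 : q * (s + d) ^ 3 ≤ q * (1 / 64) := by
      refine mul_le_mul_of_nonneg_left ?_ hq0.le
      calc (s + d) ^ 3 ≤ (1 / 4) ^ 3 := pow_le_pow_left₀ (by linarith) hs4 3
        _ = _ := by norm_num
    have hsec1 : q * (s * d ^ 2) ≤ d ^ 2 / 4 := by
      refine (hqu _ (mul_nonneg (by linarith) (sq_nonneg d))).trans ?_
      have := mul_le_mul_of_nonneg_right (by linarith : s ≤ 1 / 4) (sq_nonneg d)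
      linarith
    have hsec0 : 0 ≤ q * (s * d ^ 2) := mul_nonneg hq0.le (mul_nonneg (by linarith) (sq_nonneg d))
    have hfst : q * (s + d) ^ 3 - q * s ^ 3 ≤ 7 / 16 * d := by
      have e : q * (s + d) ^ 3 - q * s ^ 3 = q * (d * (3 * s ^ 2 + 3 * s * d + d ^ 2)) := by ring
      have hs0 : 0 ≤ s := hd.le.trans hsd
      have hs4' : s ≤ 1 / 4 := by linarith
      have hss0 : s * s ≤ s * (1 / 4) := mul_le_mul_of_nonneg_left hs4' hs0
      have hsd0 : s * d ≤ 1 / 4 * d := mul_le_mul_of_nonneg_right hs4' hd.le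
      have hss : 3 * s ^ 2 + 3 * s * d + d ^ 2 ≤ 7 / 16 := by linarith
      rw [e]
      refine (hqu _ (by positivity)).trans ?_
      have := mul_le_mul_of_nonneg_left hss hd.le
      linarith
    have f1 : s + 1 / 4 - d - 1 / 4 = s - d := by ring
    have f2 : s + 1 / 4 - 1 / 4 = s := by ring
    have f3 : s + 1 / 4 + d - 1 / 4 = s + d := by ring
    rw [e1, e2, e3, f1, f2, f3]
    have hls : lam * d ≤ lam * s := mul_le_mul_of_nonneg_left hsd hl0.le
    have hls4 : lam * (s + d) ≤ lam * (1 / 4) := mul_le_mul_of_nonneg_left hs4 hl0.le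
    refine ⟨?_, ?_, ?_, ?_, ?_, ?_⟩ <;> linarith
  · have e1 : ψ (1 / 2 - d) = 32 * q * (1 / 2 - d - 1 / 4) ^ 3 + 4 * lam * (1 / 2 - d) :=
      shishkinPsi_of_mem (by linarith) (by linarith)
    have e2 : ψ (1 / 2) = 1 / 2 := by
      have : ψ (1 / 2) = 32 * q * (1 / 2 - 1 / 4) ^ 3 + 4 * lam * (1 / 2) :=
        shishkinPsi_of_mem (by norm_num) le_rfl
      rw [this, hq]
      ring
    have e3 : ψ (1 / 2 + d) = 1 - ψ (1 / 2 - d) := by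
      rw [← shishkinPsi_one_sub (by linarith : 1 / 2 - d < 1 / 2)]
      congr 1
      ring
    have hc0 : 0 ≤ q * (1 / 2 - d - 1 / 4) ^ 3 :=
      mul_nonneg hq0.le (pow_nonneg (by linarith) 3)
    have hqd : q * d ^ 2 ≤ q * d / 4 := by
      have := mul_le_mul_of_nonneg_left hd2 hq0.le
      linarith
    have hqd' : q * d ^ 3 ≤ q * d ^ 2 / 4 := by
      have := mul_le_mul_of_nonneg_left hd3 hq0.le
      linarith
    rw [e3, e2]
    refine ⟨?_, ?_, ?_, ?_, ?_, ?_⟩ <;> rw [e1] <;> linarith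

theorem abs_half_stencil_le {s C β K δ w v d : ℝ} (hs : 0 < s) (hC : 1 ≤ C) (hβ : 0 < β)
    (hw : |w| ≤ δ) (hv : |v| ≤ δ) (h : |β * (w - C * v) - s * d| ≤ β * K * (C - 1)) :
    |(C + 1) / s * (w - v) - 2 * d / β| ≤ (2 * K + 2 * δ) * ((C - 1) / s) := by
  have e : (C + 1) / s * (w - v) - 2 * d / β =
      2 * (β * (w - C * v) - s * d) / (β * s) + (C - 1) / s * (w + v) := by
    field_simp
    ring
  have hA : 0 ≤ (C - 1) / s := div_nonneg (by linarith) hs.le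
  rw [e]
  refine (abs_add_le _ _).trans ?_
  have h1 : |2 * (β * (w - C * v) - s * d) / (β * s)| ≤ 2 * K * ((C - 1) / s) := by
    rw [abs_div, abs_mul, abs_of_pos (mul_pos hβ hs), abs_two, div_le_iff₀ (by positivity)]
    have : 2 * K * ((C - 1) / s) * (β * s) = 2 * (β * K * (C - 1)) := by field_simp
    rw [this]
    linarith
  have h2 : |(C - 1) / s * (w + v)| ≤ (C - 1) / s * (2 * δ) := by
    rw [abs_mul, abs_of_nonneg hA]
    exact mul_le_mul_of_nonneg_left ((abs_add_le _ _).trans (by linarith)) hA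
  linarith

theorem Acoef_pos {β h : ℝ} (hβ : 0 < β) (hh : 0 < h) : 0 < Acoef β h :=
  div_pos (sub_pos.2 (Real.one_lt_cosh.2 (mul_pos hβ hh).ne')) (Real.sinh_pos_iff.2 (mul_pos hβ hh))

theorem abs_stencil_le {v v1 v2 : ℝ → ℝ} {a hl hr β K δ : ℝ} (hβ : 0 < β) (hhl : 0 < hl)
    (hhr : 0 < hr) (hv : ContinuousOn v (Set.Icc (a - hl) (a + hr)))
    (hv1 : ContinuousOn v1 (Set.Icc (a - hl) (a + hr)))
    (hd : ∀ x ∈ Set.Ioo (a - hl) (a + hr), HasDerivAt v (v1 x) x)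
    (hd1 : ∀ x ∈ Set.Ioo (a - hl) (a + hr), HasDerivAt v1 (v2 x) x)
    (hK : ∀ x ∈ Set.Ioo (a - hl) (a + hr), |v2 x - β ^ 2 * v x| ≤ β ^ 2 * K)
    (hδ : ∀ x ∈ Set.Icc (a - hl) (a + hr), |v x| ≤ δ) :
    |Bcoef β hl * (v (a - hl) - v a) + Bcoef β hr * (v (a + hr) - v a)| ≤
      (2 * K + 2 * δ) * (Acoef β hl + Acoef β hr) := by
  have hr1 : Set.Icc a (a + hr) ⊆ Set.Icc (a - hl) (a + hr) := Set.Icc_subset_Icc (by linarith) le_rfl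
  have hr2 : Set.Ioo a (a + hr) ⊆ Set.Ioo (a - hl) (a + hr) := Set.Ioo_subset_Ioo (by linarith) le_rfl
  have hl1 : Set.Icc (a - hl) a ⊆ Set.Icc (a - hl) (a + hr) := Set.Icc_subset_Icc le_rfl (by linarith)
  have hl2 : Set.Ioo (a - hl) a ⊆ Set.Ioo (a - hl) (a + hr) := Set.Ioo_subset_Ioo le_rfl (by linarith)
  have kr := abs_two_point_right hβ hhr.le (hv.mono hr1) (hv1.mono hr1)
    (fun x hx => hd x (hr2 hx)) (fun x hx => hd1 x (hr2 hx)) (fun x hx => hK x (hr2 hx))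
  have kl := abs_two_point_left hβ hhl.le (hv.mono hl1) (hv1.mono hl1)
    (fun x hx => hd x (hl2 hx)) (fun x hx => hd1 x (hl2 hx)) (fun x hx => hK x (hl2 hx))
  have hva := hδ a ⟨by linarith, by linarith⟩
  have sr := abs_half_stencil_le (Real.sinh_pos_iff.2 (mul_pos hβ hhr)) (Real.one_le_cosh _) hβ
    (hδ (a + hr) ⟨by linarith, le_rfl⟩) hva kr
  rw [← sub_neg_eq_add, ← mul_neg] at kl
  have sl := abs_half_stencil_le (Real.sinh_pos_iff.2 (mul_pos hβ hhl)) (Real.one_le_cosh _) hβ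
    (hδ (a - hl) ⟨le_rfl, by linarith⟩) hva kl
  have e : Bcoef β hl * (v (a - hl) - v a) + Bcoef β hr * (v (a + hr) - v a) =
      (Bcoef β hl * (v (a - hl) - v a) - 2 * -v1 a / β) +
        (Bcoef β hr * (v (a + hr) - v a) - 2 * v1 a / β) := by ring
  rw [e]
  refine (abs_add_le _ _).trans ((add_le_add sl sr).trans ?_)
  simp only [Acoef]
  linarith

theorem abs_Bcoef_mul_sub_le {β hl hr : ℝ} (hβ : 0 < β) (hhl : 0 < hl) (hlr : hl ≤ hr) :
    |Bcoef β hr * hr - Bcoef β hl * hl| ≤ (hr - hl) * Acoef β hr := by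
  have h := abs_mul_coth_sub_le (mul_pos hβ hhl) (mul_le_mul_of_nonneg_left hlr hβ.le)
  have e : β * hr * ((Real.cosh (β * hr) + 1) / Real.sinh (β * hr)) -
      β * hl * ((Real.cosh (β * hl) + 1) / Real.sinh (β * hl)) =
      β * (Bcoef β hr * hr - Bcoef β hl * hl) := by
    simp only [Bcoef]
    ring
  rw [e, abs_mul, abs_of_pos hβ, ← mul_sub, mul_assoc] at h
  exact le_of_mul_le_mul_left h hβ

theorem abs_residual_le {y y1 y2 : ℝ → ℝ} {a hl hr β γ δ η L b c fl fa fr : ℝ} (hβ : 0 < β)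
    (hγ : 0 < γ) (hhl : 0 < hl) (hlr : hl ≤ hr)
    (hy : ContinuousOn y (Set.Icc (a - hl) (a + hr)))
    (hy1 : ContinuousOn y1 (Set.Icc (a - hl) (a + hr)))
    (hd : ∀ x ∈ Set.Ioo (a - hl) (a + hr), HasDerivAt y (y1 x) x)
    (hd1 : ∀ x ∈ Set.Ioo (a - hl) (a + hr), HasDerivAt y1 (y2 x) x)
    (hδ2 : ∀ x ∈ Set.Ioo (a - hl) (a + hr), |y2 x| ≤ β ^ 2 * δ)
    (hδ : ∀ x ∈ Set.Icc (a - hl) (a + hr), |y x - b - c * (x - a)| ≤ δ)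
    (hc : |c| ≤ L) (hη : hr - hl ≤ η)
    (hfl : |fl| ≤ γ * δ) (hfa : |fa| ≤ γ * δ) (hfr : |fr| ≤ γ * δ) :
    |γ / (Acoef β hl + Acoef β hr) *
      (Bcoef β hl * y (a - hl) - (Bcoef β hl + Bcoef β hr) * y a + Bcoef β hr * y (a + hr) -
        (fl + fa) * Acoef β hl / γ - (fa + fr) * Acoef β hr / γ)| ≤ γ * (8 * δ + L * η) := by
  have hhr : 0 < hr := hhl.trans_le hlr
  have hAl := Acoef_pos hβ hhl
  have hAr := Acoef_pos hβ hhr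
  have hst := abs_stencil_le (v := fun x => y x - b - c * (x - a)) (v1 := fun x => y1 x - c)
    (v2 := y2) (K := 2 * δ) hβ hhl hhr (by fun_prop) (by fun_prop)
    (fun x hx => by
      convert! ((hd x hx).sub_const b).sub (((hasDerivAt_id x).sub_const a).const_mul c) using 1
      ring)
    (fun x hx => (hd1 x hx).sub_const c)
    (fun x hx => by
      have h1 := hδ x (Set.Ioo_subset_Icc_self hx)
      have h2 := hδ2 x hx
      refine (abs_sub _ _).trans ?_
      rw [abs_mul, abs_of_nonneg (sq_nonneg β)]
      have := mul_le_mul_of_nonneg_left h1 (sq_nonneg β)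
      linarith) hδ
  have hlin := abs_Bcoef_mul_sub_le hβ hhl hlr
  have hlin' : |c * (Bcoef β hr * hr - Bcoef β hl * hl)| ≤ L * (η * Acoef β hr) := by
    rw [abs_mul]
    exact mul_le_mul hc (hlin.trans (mul_le_mul_of_nonneg_right hη hAr.le)) (abs_nonneg _)
      ((abs_nonneg c).trans hc)
  have hsrc : ∀ p q A : ℝ, 0 < A → |p| ≤ γ * δ → |q| ≤ γ * δ → |(p + q) * A / γ| ≤ 2 * δ * A := by
    intro p q A hA hp hq
    rw [abs_div, abs_mul, abs_of_pos hA, abs_of_pos hγ, div_le_iff₀ hγ]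
    have := mul_le_mul_of_nonneg_right ((abs_add_le p q).trans (add_le_add hp hq)) hA.le
    linarith
  have s1 := hsrc fl fa _ hAl hfl hfa
  have s2 := hsrc fa fr _ hAr hfa hfr
  have hLη : 0 ≤ L * (η * Acoef β hl) :=
    mul_nonneg ((abs_nonneg c).trans hc) (mul_nonneg (by linarith) hAl.le)
  rw [abs_mul, abs_of_pos (by positivity), div_mul_eq_mul_div, div_le_iff₀ (by positivity), mul_assoc]
  refine mul_le_mul_of_nonneg_left ?_ hγ.le
  rw [abs_le] at *
  constructor <;> linarith [hst.1, hst.2, hlin'.1, hlin'.2, s1.1, s1.2, s2.1, s2.2]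

theorem exp_layer_le {ε m x : ℝ} {N : ℕ} (hε : 0 < ε) (hm : 0 < m) (hN : 0 < N)
    (hx : 2 * ε * Real.log N / Real.sqrt m * (1 - 4 * (1 / N)) ≤ x) :
    Real.exp (-(Real.sqrt m / ε) * x) ≤ Real.exp 8 / (N : ℝ) ^ 2 := by
  have hs : 0 < Real.sqrt m := Real.sqrt_pos.2 hm
  have hNr : (0 : ℝ) < N := Nat.cast_pos.2 hN
  have hlog : Real.log N / N ≤ 1 := (div_le_one hNr).2 (Real.log_le_self hNr.le)
  have h := mul_le_mul_of_nonneg_left hx (div_pos hs hε).le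
  have e : Real.sqrt m / ε * (2 * ε * Real.log N / Real.sqrt m * (1 - 4 * (1 / N))) =
      2 * Real.log N - 8 * (Real.log N / N) := by
    field_simp
    ring
  rw [e] at h
  calc Real.exp (-(Real.sqrt m / ε) * x) ≤ Real.exp (8 - (2 : ℕ) * Real.log N) :=
        Real.exp_le_exp.2 (by push_cast; linarith)
    _ = _ := by rw [Real.exp_sub, Real.exp_nat_mul, Real.exp_log hNr]

/-- Consistency error in the middle part of the modified Shishkin mesh: if
`ε ≤ C₀/N` and `λ = 2ε ln N/√m < 1/4`, the scheme applied to the exact solution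
satisfies `|T(y(x_0),…,y(x_N))_i| ≤ C N⁻²` for `i = N/4,…,N/2`. -/
theorem consistency_middle_part
    (m γ : ℝ) (k : ℕ) (f : ℝ → ℝ → ℝ)
    (hm : 0 < m) (hk : 2 ≤ k)
    (hf : ContDiffOn ℝ k (Function.uncurry f) (Set.Icc 0 1 ×ˢ Set.univ))
    (hfy : ∀ a ∈ Set.Icc (0:ℝ) 1, ∀ u : ℝ, m ≤ deriv (f a) u)
    (hγ : ∀ a ∈ Set.Icc (0:ℝ) 1, ∀ u : ℝ, deriv (f a) u ≤ γ) :
    ∃ C₀ > (0:ℝ), ∃ C > (0:ℝ), ∀ (ε : ℝ) (N : ℕ) (y : ℝ → ℝ),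
      0 < ε → ε < 1 → 0 < N → 4 ∣ N → ε ≤ C₀ / N →
      ContDiffOn ℝ 2 y (Set.Icc 0 1) → y 0 = 0 → y 1 = 0 →
      (∀ a ∈ Set.Ioo (0:ℝ) 1,
        ε ^ 2 * iteratedDerivWithin 2 y (Set.Icc 0 1) a = f a (y a)) →
      2 * ε * Real.log N / Real.sqrt m < 1 / 4 →
      let lam : ℝ := 2 * ε * Real.log N / Real.sqrt m
      let β : ℝ := Real.sqrt γ / ε
      let x : ℕ → ℝ := fun i => shishkinPsi lam ((i : ℝ) / (N : ℝ))
      ∀ i : ℕ, N / 4 ≤ i → i ≤ N / 2 →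
        |Tdisc f γ β x N (fun j => y (x j)) i| ≤ C / (N : ℝ) ^ 2 := by
  have hf2 : ContDiffOn ℝ 2 (Function.uncurry f) (Set.Icc 0 1 ×ˢ Set.univ) :=
    hf.of_le (by exact_mod_cast hk)
  obtain ⟨hslope, g, c, R, L, M, hR, hL, hM, hg, hgc⟩ := exists_reduced_solution hm hf2 hfy hγ
  have hγm : m ≤ γ := (hfy 0 (by simp) 0).trans (hγ 0 (by simp) 0)
  have hγ0 : 0 < γ := hm.trans_le hγm
  set C1 := R * (2 * Real.exp 8) + 2 * M / m with hC1
  have hC1n : 0 ≤ C1 := by positivity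
  refine ⟨1, one_pos, γ * (8 * (C1 + 225 * M) + L * 48) + 1, by positivity, ?_⟩
  intro ε N y hε hε1 hN hN4 hεN hy hy0 hy1 hode hlam lam β x i hi1 hi2
  obtain ⟨n, hNdef⟩ := hN4
  have hn : 1 ≤ n := by omega
  have hi1' : n ≤ i := by omega
  have hi2' : i ≤ 2 * n := by omega
  have hNr : (4 : ℝ) ≤ N := by exact_mod_cast (by omega : 4 ≤ N)
  have hN0 : (0 : ℝ) < N := by linarith
  set d : ℝ := 1 / N with hd
  have hd0 : 0 < d := by positivity
  have hd4 : d ≤ 1 / 4 := one_div_le_one_div_of_le (by norm_num) hNr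
  have hdN : d * N = 1 := by rw [hd]; field_simp
  have hlam0 : 0 < lam := by
    have : 0 < Real.log N := Real.log_pos (by linarith)
    have : 0 < Real.sqrt m := Real.sqrt_pos.2 hm
    positivity
  have hβ : 0 < β := div_pos (Real.sqrt_pos.2 hγ0) hε
  have hβ2 : ε ^ 2 * β ^ 2 = γ := by
    simp only [β]
    rw [div_pow, Real.sq_sqrt hγ0.le]
    field_simp
  have hεd : ε ≤ d := hεN
  have hε2 : ε ^ 2 ≤ d ^ 2 := pow_le_pow_left₀ hε.le hεd 2
  -- regularity of the solution
  have hud : UniqueDiffOn ℝ (Set.Icc (0 : ℝ) 1) := uniqueDiffOn_Icc one_pos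
  set y1 := derivWithin y (Set.Icc 0 1) with hy1def
  set y2 := iteratedDerivWithin 2 y (Set.Icc 0 1) with hy2def
  have hyc : ContinuousOn y (Set.Icc 0 1) := hy.continuousOn
  have hy1c : ContinuousOn y1 (Set.Icc 0 1) := hy.continuousOn_derivWithin hud (by norm_num)
  have hyd : ∀ a ∈ Set.Ioo (0 : ℝ) 1, HasDerivAt y (y1 a) a := fun a ha =>
    ((hy.differentiableOn (by norm_num)) a
      (Set.Ioo_subset_Icc_self ha)).hasDerivWithinAt.hasDerivAt (Icc_mem_nhds ha.1 ha.2)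
  have hy1d : ∀ a ∈ Set.Ioo (0 : ℝ) 1, HasDerivAt y1 (y2 a) a := fun a ha => by
    have h := hy.differentiableOn_iteratedDerivWithin (m := 1) (by norm_num) hud a
      (Set.Ioo_subset_Icc_self ha)
    have h2 := h.hasDerivWithinAt.hasDerivAt (Icc_mem_nhds ha.1 ha.2)
    rw [← iteratedDerivWithin_succ, iteratedDerivWithin_one] at h2
    exact h2
  -- distance to the reduced solution
  have hup := sub_le_layer_barrier (c := c) hε hm hR hM hyc hg hyd hy1d
    (fun a ha t ht => by linarith [(abs_le.1 ((hgc a ha).2.2.2 t ht)).2])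
    (fun a ha hpos => by
      have ha' := Set.Ioo_subset_Icc_self ha
      have := (hslope a ha' (g a) (y a) (by linarith)).1
      rw [(hgc a ha').1] at this
      rw [hode a ha]
      linarith)
    (by linarith [(abs_le.1 (hgc 0 (by simp)).2.1).1])
    (by linarith [(abs_le.1 (hgc 1 (by simp)).2.1).1])
  have hlo := sub_le_layer_barrier (y := -y) (y1 := -y1) (y2 := -y2) (g := -g) (c := -c)
    hε hm hR hM hyc.neg hg.neg
    (fun a ha => (hyd a ha).neg) (fun a ha => (hy1d a ha).neg)
    (fun a ha t ht => by
      simp only [Pi.neg_apply]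
      linarith [(abs_le.1 ((hgc a ha).2.2.2 t ht)).1])
    (fun a ha hpos => by
      simp only [Pi.neg_apply] at hpos ⊢
      have ha' := Set.Ioo_subset_Icc_self ha
      have := (hslope a ha' (y a) (g a) (by linarith)).1
      rw [(hgc a ha').1] at this
      rw [mul_neg, hode a ha]
      linarith)
    (by
      simp only [Pi.neg_apply]
      linarith [(abs_le.1 (hgc 0 (by simp)).2.1).2])
    (by
      simp only [Pi.neg_apply]
      linarith [(abs_le.1 (hgc 1 (by simp)).2.1).2])
  have hw : ∀ a, lam * (1 - 4 * d) ≤ a → a ≤ 1 - lam * (1 - 4 * d) →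
      |y a - g a| ≤ C1 * d ^ 2 := by
    intro a ha1 ha2
    have hl0 : 0 ≤ lam * (1 - 4 * d) := mul_nonneg hlam0.le (by linarith)
    have ha : a ∈ Set.Icc (0 : ℝ) 1 := ⟨by linarith, by linarith⟩
    have b1 := exp_layer_le hε hm hN ha1
    have b2 := exp_layer_le (x := 1 - a) hε hm hN
      (by simp only [lam, hd] at ha2 ⊢; linarith)
    have e : Real.exp 8 / (N : ℝ) ^ 2 = Real.exp 8 * d ^ 2 := by
      rw [hd]
      field_simp
    rw [e] at b1 b2
    have hbound : R * (Real.exp (-(Real.sqrt m / ε) * a) + Real.exp (-(Real.sqrt m / ε) * (1 - a))) +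
        2 * M / m * ε ^ 2 ≤ C1 * d ^ 2 := by
      have h1 := mul_le_mul_of_nonneg_left (add_le_add b1 b2) hR
      have h2 := mul_le_mul_of_nonneg_left hε2 (by positivity : 0 ≤ 2 * M / m)
      rw [hC1]
      linarith
    have h3 := hup a ha
    have h4 := hlo a ha
    simp only [Pi.neg_apply] at h4
    exact abs_le.2 ⟨by linarith, by linarith⟩
  have hfw : ∀ a ∈ Set.Icc (0 : ℝ) 1, |f a (y a)| ≤ γ * |y a - g a| := by
    intro a ha
    have hfg := (hgc a ha).1
    rcases le_total (g a) (y a) with h | h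
    · have := hslope a ha _ _ h
      rw [hfg, sub_zero] at this
      have h0 : 0 ≤ m * (y a - g a) := mul_nonneg hm.le (sub_nonneg.2 h)
      rw [abs_of_nonneg (sub_nonneg.2 h), abs_of_nonneg (by linarith)]
      exact this.2
    · have := hslope a ha _ _ h
      rw [hfg, zero_sub] at this
      have h0 : 0 ≤ m * (g a - y a) := mul_nonneg hm.le (sub_nonneg.2 h)
      rw [abs_of_nonpos (sub_nonpos.2 h), abs_of_nonpos (by linarith)]
      linarith [this.2]
  -- the mesh
  have hnN : (n : ℝ) * d = 1 / 4 := by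
    have : (N : ℝ) = 4 * n := by rw [hNdef]; push_cast; ring
    rw [this] at hdN
    linarith
  set t : ℝ := i * d with ht
  have htcases : t = 1 / 4 ∨ (1 / 4 + d ≤ t ∧ t + d ≤ 1 / 2) ∨ t = 1 / 2 := by
    rcases eq_or_lt_of_le hi1' with h | h
    · left
      rw [ht, ← h, hnN]
    rcases eq_or_lt_of_le hi2' with h' | h'
    · right; right
      rw [ht, h']
      push_cast
      linarith
    · right; left
      have k1 : ((n : ℝ) + 1) ≤ i := by exact_mod_cast h
      have k2 : (i : ℝ) + 1 ≤ 2 * n := by exact_mod_cast h'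
      have k1' := mul_le_mul_of_nonneg_right k1 hd0.le
      have k2' := mul_le_mul_of_nonneg_right k2 hd0.le
      constructor <;> linarith
  obtain ⟨m1, m2, m3, m4, m5, m6⟩ := shishkinPsi_neighbours hlam0 hlam hd0 hd4 htcases
  have hxi : x i = shishkinPsi lam t := by
    simp only [x, ht, hd]
    congr 1
    ring
  have hxl : x (i - 1) = shishkinPsi lam (t - d) := by
    simp only [x, ht, hd]
    rw [Nat.cast_sub (by omega)]
    congr 1
    push_cast
    ring
  have hxr : x (i + 1) = shishkinPsi lam (t + d) := by
    simp only [x, ht, hd]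
    congr 1
    push_cast
    ring
  rw [← hxi, ← hxl] at m1
  rw [← hxi, ← hxl, ← hxr] at m2 m4
  rw [← hxi, ← hxr] at m3
  rw [← hxl] at m5
  rw [← hxr] at m6
  have hl0 : 0 ≤ lam * (1 - 4 * d) := mul_nonneg hlam0.le (by linarith)
  have hI : Set.Icc (x (i - 1)) (x (i + 1)) ⊆ Set.Icc 0 1 :=
    Set.Icc_subset_Icc (by linarith) (by linarith)
  have hIo : Set.Ioo (x (i - 1)) (x (i + 1)) ⊆ Set.Ioo 0 1 :=
    Set.Ioo_subset_Ioo (by linarith) (by linarith)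
  have hC12 : C1 * d ^ 2 ≤ (C1 + 225 * M) * d ^ 2 :=
    mul_le_mul_of_nonneg_right (by linarith) (sq_nonneg d)
  have hwI : ∀ a ∈ Set.Icc (x (i - 1)) (x (i + 1)), |y a - g a| ≤ C1 * d ^ 2 := fun a ha =>
    hw a (m5.trans ha.1) (ha.2.trans m6)
  have hfI : ∀ a ∈ Set.Icc (x (i - 1)) (x (i + 1)), |f a (y a)| ≤ γ * ((C1 + 225 * M) * d ^ 2) :=
    fun a ha => (hfw a (hI ha)).trans
      (mul_le_mul_of_nonneg_left ((hwI a ha).trans hC12) hγ0.le)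
  have hxmem : x i ∈ Set.Icc (x (i - 1)) (x (i + 1)) := ⟨by linarith, by linarith⟩
  have el : x i - (x i - x (i - 1)) = x (i - 1) := by ring
  have er : x i + (x (i + 1) - x i) = x (i + 1) := by ring
  have key := abs_residual_le (y := y) (y1 := y1) (y2 := y2) (a := x i) (hl := x i - x (i - 1))
    (hr := x (i + 1) - x i) (β := β) (γ := γ) (δ := (C1 + 225 * M) * d ^ 2) (η := 48 * d ^ 2)
    (L := L) (b := g (x i)) (c := c (x i)) (fl := f (x (i - 1)) (y (x (i - 1))))
    (fa := f (x i) (y (x i))) (fr := f (x (i + 1)) (y (x (i + 1)))) hβ hγ0 (by linarith) m2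
    (by rw [el, er]; exact hyc.mono hI) (by rw [el, er]; exact hy1c.mono hI)
    (by rw [el, er]; exact fun a ha => hyd a (hIo ha))
    (by rw [el, er]; exact fun a ha => hy1d a (hIo ha))
    (by
      rw [el, er]
      intro a ha
      have h := hfI a (Set.Ioo_subset_Icc_self ha)
      rw [← hode a (hIo ha), abs_mul, abs_of_pos (by positivity : 0 < ε ^ 2), ← hβ2, mul_assoc] at h
      exact le_of_mul_le_mul_left h (by positivity))
    (by
      rw [el, er]
      intro a ha
      have h1 := hwI a ha
      have h2 := (hgc (x i) (hI hxmem)).2.2.2 a (hI ha)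
      have h3 : (a - x i) ^ 2 ≤ 225 * d ^ 2 := by
        have : |a - x i| ≤ 15 * d := abs_le.2 ⟨by linarith [ha.1], by linarith [ha.2]⟩
        have := pow_le_pow_left₀ (abs_nonneg _) this 2
        rw [sq_abs] at this
        linarith
      have h4 := mul_le_mul_of_nonneg_left h3 hM
      have e : y a - g (x i) - c (x i) * (a - x i) =
          (y a - g a) + (g a - g (x i) - c (x i) * (a - x i)) := by ring
      rw [e]
      refine (abs_add_le _ _).trans ?_
      linarith)
    (hgc (x i) (hI hxmem)).2.2.1 m4 (hfI _ ⟨le_rfl, by linarith⟩) (hfI _ hxmem)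
    (hfI _ ⟨by linarith, le_rfl⟩)
  rw [el, er] at key
  have hne : ¬ (i = 0 ∨ i = N) := by omega
  have hsucc : i - 1 + 1 = i := by omega
  simp only [Tdisc, if_neg hne, hsucc]
  refine key.trans ?_
  have hfin : (γ * (8 * (C1 + 225 * M) + L * 48) + 1) / (N : ℝ) ^ 2 =
      (γ * (8 * (C1 + 225 * M) + L * 48) + 1) * d ^ 2 := by
    rw [hd]
    field_simp
  rw [hfin]
  linarith [sq_nonneg d]
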